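/- arXiv:2503.05523 — 2 statements merged into one kernel-verified Lean document; each statement's English description precedes it below -/
import Mathlib

section
/- Let a₁, a₂ ∈ ℝ³ be unit vectors with angle α ∈ (0, π) between them (so a₁ ∦ a₂), let b₁ ∈ ℝ³ be a unit vector, let s ∈ {+1, −1}, and set b₂ := s·b₁ (so b₁ ∥ b₂). Set A_i := a_i·σ and B_j := b_j·σ. Then for real numbers γ₁₁, γ₂₁, γ₁₂, γ₂₂, there exists a density matrix ρ on ℂ²⊗ℂ² with Tr[ρ (A_i ⊗ B_j)] = γ_{ij} for all i, j ∈ {1,2} if and only if γ₁₁ = s·γ₁₂, γ₂₁ = s·γ₂₂, and √(γ₁₁² + γ₂₁² − 2 cos(α) γ₁₁ γ₂₁) ≤ sin(α). -/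
open Matrix Kronecker Real ComplexOrder

noncomputable section

def σ1 : Matrix (Fin 2) (Fin 2) ℂ := !![0, 1; 1, 0]
def σ2 : Matrix (Fin 2) (Fin 2) ℂ := !![0, -Complex.I; Complex.I, 0]
def σ3 : Matrix (Fin 2) (Fin 2) ℂ := !![1, 0; 0, -1]

/-- For `a ∈ ℝ³`, `a·σ := a₁σ₁ + a₂σ₂ + a₃σ₃`. -/
def dotSigma (a : Fin 3 → ℝ) : Matrix (Fin 2) (Fin 2) ℂ :=
  (a 0 : ℂ) • σ1 + (a 1 : ℂ) • σ2 + (a 2 : ℂ) • σ3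

/-- Euclidean dot product on `ℝ³`. -/
def dot3 (a b : Fin 3 → ℝ) : ℝ := a 0 * b 0 + a 1 * b 1 + a 2 * b 2

/-- A density matrix on `ℂ² ⊗ ℂ²`: positive semidefinite with trace 1. -/
def IsDensityMatrix (ρ : Matrix (Fin 2 × Fin 2) (Fin 2 × Fin 2) ℂ) : Prop :=
  ρ.PosSemidef ∧ ρ.trace = 1

/-- The matrix `F_{α,β}`. -/
def Fmat (α β : ℝ) : Matrix (Fin 4) (Fin 4) ℝ :=
  (1 / (Real.sin α ^ 2 * Real.sin β ^ 2)) •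
    !![1, -Real.cos α, -Real.cos β, Real.cos (α + β);
       -Real.cos α, 1, Real.cos (α - β), -Real.cos β;
       -Real.cos β, Real.cos (α - β), 1, -Real.cos α;
       Real.cos (α + β), -Real.cos β, -Real.cos α, 1]

/-- The quadratic form `γᵀ F_{α,β} γ`. -/
def quadForm (α β : ℝ) (γ : Fin 4 → ℝ) : ℝ := γ ⬝ᵥ (Fmat α β *ᵥ γ)


lemma ds_herm (a : Fin 3 → ℝ) : (dotSigma a)ᴴ = dotSigma a := by
  ext i j
  fin_cases i <;> fin_cases j <;> simp [dotSigma, σ1, σ2, σ3, Matrix.conjTranspose_apply]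

lemma ds_sq (a : Fin 3 → ℝ) : dotSigma a * dotSigma a = ((dot3 a a : ℝ) : ℂ) • 1 := by
  have hI := Complex.I_sq
  ext i j
  fin_cases i <;> fin_cases j <;>
    simp [dotSigma, σ1, σ2, σ3, dot3, Matrix.mul_apply, Fin.sum_univ_two] <;>
    first | ring1 | linear_combination (-(a 1 : ℂ) ^ 2) * hI

lemma ds_trace (a : Fin 3 → ℝ) : (dotSigma a).trace = 0 := by
  simp [dotSigma, σ1, σ2, σ3, Matrix.trace, Fin.sum_univ_two]

lemma ds_trace_mul (a b : Fin 3 → ℝ) :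
    (dotSigma a * dotSigma b).trace = 2 * ((dot3 a b : ℝ) : ℂ) := by
  have hI := Complex.I_sq
  simp [dotSigma, σ1, σ2, σ3, dot3, Matrix.trace, Matrix.mul_apply, Fin.sum_univ_two]
  linear_combination (-2 * (a 1 : ℂ) * b 1) * hI

lemma ds_lin (x y : ℝ) (a b : Fin 3 → ℝ) :
    dotSigma (x • a + y • b) = (x : ℂ) • dotSigma a + (y : ℂ) • dotSigma b := by
  simp only [dotSigma, Pi.add_apply, Pi.smul_apply, smul_eq_mul]
  push_cast
  module

lemma ds_smul (x : ℝ) (a : Fin 3 → ℝ) :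
    dotSigma (x • a) = (x : ℂ) • dotSigma a := by
  simp only [dotSigma, Pi.smul_apply, smul_eq_mul]
  push_cast
  module

lemma K_herm (a b : Fin 3 → ℝ) :
    (dotSigma a ⊗ₖ dotSigma b)ᴴ = dotSigma a ⊗ₖ dotSigma b := by
  rw [Matrix.conjTranspose_kronecker, ds_herm, ds_herm]

lemma K_sq (a b : Fin 3 → ℝ) (hb : dot3 b b = 1) :
    (dotSigma a ⊗ₖ dotSigma b) * (dotSigma a ⊗ₖ dotSigma b) = ((dot3 a a : ℝ) : ℂ) • 1 := by
  rw [← Matrix.mul_kronecker_mul, ds_sq, ds_sq, hb]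
  simp [Matrix.smul_kronecker]

lemma bound_aux (ρ : Matrix (Fin 2 × Fin 2) (Fin 2 × Fin 2) ℂ) (h : IsDensityMatrix ρ)
    (c b : Fin 3 → ℝ) (hb : dot3 b b = 1) (x : ℝ)
    (hx : (ρ * (dotSigma c ⊗ₖ dotSigma b)).trace = (x : ℂ)) : x ^ 2 ≤ dot3 c c := by
  obtain ⟨hp, ht⟩ := h
  set K := dotSigma c ⊗ₖ dotSigma b with hK
  have hKh : Kᴴ = K := K_herm c b
  have hKs : K * K = ((dot3 c c : ℝ) : ℂ) • 1 := K_sq c b hb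
  have h1 := (hp.mul_mul_conjTranspose_same ((x : ℂ) • 1 - K)).trace_nonneg
  have h2 : (((x : ℂ) • 1 - K) * ρ * ((x : ℂ) • 1 - K)ᴴ).trace = ((dot3 c c - x ^ 2 : ℝ) : ℂ) := by
    have e : ((x : ℂ) • (1 : Matrix (Fin 2 × Fin 2) (Fin 2 × Fin 2) ℂ) - K)ᴴ = (x : ℂ) • 1 - K := by
      simp [hKh]
    have e2 : ((x : ℂ) • (1 : Matrix (Fin 2 × Fin 2) (Fin 2 × Fin 2) ℂ) - K) * ((x : ℂ) • 1 - K)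
        = ((x : ℂ) ^ 2 + (dot3 c c : ℝ)) • 1 - (2 * x : ℂ) • K := by
      simp only [sub_mul, mul_sub, hKs, Matrix.smul_mul, Matrix.mul_smul, one_mul, mul_one]
      module
    rw [e, Matrix.mul_assoc, Matrix.trace_mul_comm, Matrix.mul_assoc, e2, Matrix.mul_sub,
      Matrix.mul_smul, Matrix.mul_smul, Matrix.trace_sub, Matrix.trace_smul, Matrix.trace_smul,
      hx, mul_one, ht]
    simp only [smul_eq_mul]
    push_cast
    ring
  rw [h2] at h1
  have := Complex.zero_le_real.mp h1
  linarith

lemma exists_aux (t b : Fin 3 → ℝ) (hb : dot3 b b = 1) (ht : dot3 t t ≤ 1) :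
    ∃ ρ, IsDensityMatrix ρ ∧ ∀ a, (ρ * (dotSigma a ⊗ₖ dotSigma b)).trace = ((dot3 t a : ℝ) : ℂ) := by
  set K := dotSigma t ⊗ₖ dotSigma b with hK
  have hKh : Kᴴ = K := K_herm t b
  have hKs : K * K = ((dot3 t t : ℝ) : ℂ) • 1 := K_sq t b hb
  have htr : K.trace = 0 := by rw [hK, Matrix.trace_kronecker, ds_trace, zero_mul]
  refine ⟨(1 / 4 : ℂ) • (1 + K), ⟨?_, ?_⟩, ?_⟩
  · set r := Real.sqrt (1 - dot3 t t) with hr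
    have hr2 : r ^ 2 = 1 - dot3 t t := Real.sq_sqrt (by linarith)
    have hr0 : 0 ≤ r := Real.sqrt_nonneg _
    set u := Real.sqrt ((1 + r) / 2) with hu
    have hu2 : u ^ 2 = (1 + r) / 2 := Real.sq_sqrt (by linarith)
    have hu0 : 0 < u := Real.sqrt_pos.mpr (by linarith)
    have key : (u / 2) ^ 2 + (1 / (4 * u)) ^ 2 * dot3 t t = 1 / 4 := by
      field_simp
      nlinarith
    have key2 : 2 * (u / 2) * (1 / (4 * u)) = 1 / 4 := by
      field_simp
    have key' : ((u / 2 : ℝ) : ℂ) ^ 2 + ((1 / (4 * u) : ℝ) : ℂ) ^ 2 * (dot3 t t : ℝ) = 1 / 4 := by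
      have := congrArg (fun z : ℝ => (z : ℂ)) key
      push_cast at this ⊢
      exact this
    have key2' : 2 * ((u / 2 : ℝ) : ℂ) * ((1 / (4 * u) : ℝ) : ℂ) = 1 / 4 := by
      have := congrArg (fun z : ℝ => (z : ℂ)) key2
      push_cast at this ⊢
      exact this
    generalize u / 2 = p at *
    generalize 1 / (4 * u) = q at *
    have e : (1 / 4 : ℂ) • (1 + K) = ((p : ℂ) • 1 + (q : ℂ) • K)ᴴ * ((p : ℂ) • 1 + (q : ℂ) • K) := by
      have e1 : ((p : ℂ) • (1 : Matrix (Fin 2 × Fin 2) (Fin 2 × Fin 2) ℂ) + (q : ℂ) • K)ᴴ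
          = (p : ℂ) • 1 + (q : ℂ) • K := by
        simp [hKh]
      rw [e1]
      simp only [add_mul, mul_add, hKs, Matrix.smul_mul, Matrix.mul_smul, one_mul, mul_one]
      rw [smul_add]
      nth_rewrite 1 [← key']
      rw [← key2']
      module
    rw [e]
    exact Matrix.posSemidef_conjTranspose_mul_self _
  · rw [Matrix.trace_smul, Matrix.trace_add, htr, Matrix.trace_one]
    simp
  · intro a
    rw [Matrix.smul_mul, Matrix.add_mul, one_mul, Matrix.trace_smul, Matrix.trace_add, hK,
      ← Matrix.mul_kronecker_mul, Matrix.trace_kronecker, Matrix.trace_kronecker, ds_trace,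
      ds_trace_mul, ds_trace_mul, hb]
    simp only [smul_eq_mul]
    push_cast
    ring

lemma dot3_lin (x y : ℝ) (a b c : Fin 3 → ℝ) :
    dot3 (x • a + y • b) c = x * dot3 a c + y * dot3 b c := by
  simp [dot3]; ring

lemma dot3_comm (a b : Fin 3 → ℝ) : dot3 a b = dot3 b a := by
  simp [dot3]; ring

/-- The case `a₁ ∦ a₂`, `b₂ = s·b₁` (`b₁ ∥ b₂`): the correlations are
quantum realizable iff `γ₁₁ = s γ₁₂`, `γ₂₁ = s γ₂₂` and
`√(γ₁₁² + γ₂₁² − 2 cos α γ₁₁ γ₂₁) ≤ sin α`. -/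
theorem stmt2 (a₁ a₂ b₁ : Fin 3 → ℝ) (s : ℝ) (hs : s = 1 ∨ s = -1)
    (ha₁ : dot3 a₁ a₁ = 1) (ha₂ : dot3 a₂ a₂ = 1) (hb₁ : dot3 b₁ b₁ = 1)
    (α : ℝ) (hα : α ∈ Set.Ioo 0 π) (hcα : Real.cos α = dot3 a₁ a₂)
    (γ11 γ21 γ12 γ22 : ℝ) :
    (∃ ρ : Matrix (Fin 2 × Fin 2) (Fin 2 × Fin 2) ℂ, IsDensityMatrix ρ ∧
        (ρ * (dotSigma a₁ ⊗ₖ dotSigma b₁)).trace = (γ11 : ℂ) ∧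
        (ρ * (dotSigma a₂ ⊗ₖ dotSigma b₁)).trace = (γ21 : ℂ) ∧
        (ρ * (dotSigma a₁ ⊗ₖ dotSigma (s • b₁))).trace = (γ12 : ℂ) ∧
        (ρ * (dotSigma a₂ ⊗ₖ dotSigma (s • b₁))).trace = (γ22 : ℂ)) ↔
      (γ11 = s * γ12 ∧ γ21 = s * γ22 ∧
        Real.sqrt (γ11 ^ 2 + γ21 ^ 2 - 2 * Real.cos α * γ11 * γ21) ≤ Real.sin α) := by
  have hsin : 0 < Real.sin α := Real.sin_pos_of_pos_of_lt_pi hα.1 hα.2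
  have hsc := Real.sin_sq_add_cos_sq α
  have hss : s * s = 1 := by rcases hs with h | h <;> rw [h] <;> norm_num
  have hss' : (s : ℂ) * s = 1 := by exact_mod_cast hss
  have htrs : ∀ (ρ : Matrix (Fin 2 × Fin 2) (Fin 2 × Fin 2) ℂ) (a : Fin 3 → ℝ),
      (ρ * (dotSigma a ⊗ₖ dotSigma (s • b₁))).trace =
        s * (ρ * (dotSigma a ⊗ₖ dotSigma b₁)).trace := by
    intro ρ a
    rw [ds_smul, Matrix.kronecker_smul, Matrix.mul_smul, Matrix.trace_smul, smul_eq_mul]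
  set C := Real.cos α with hC
  set S := Real.sin α with hS
  have hcc : dot3 a₂ a₁ = C := by rw [dot3_comm, hcα]
  set c : Fin 3 → ℝ := (γ11 - C * γ21) • a₁ + (γ21 - C * γ11) • a₂ with hc
  have hca₁ : dot3 c a₁ = S ^ 2 * γ11 := by
    rw [hc, dot3_lin, ha₁, hcc]; linear_combination (-γ11) * hsc
  have hca₂ : dot3 c a₂ = S ^ 2 * γ21 := by
    rw [hc, dot3_lin, ha₂, ← hcα]; linear_combination (-γ21) * hsc
  have hcn : dot3 c c = S ^ 2 * (γ11 ^ 2 + γ21 ^ 2 - 2 * C * γ11 * γ21) := by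
    conv_lhs => lhs; rw [hc]
    rw [dot3_lin, dot3_comm a₁, dot3_comm a₂, hca₁, hca₂]; ring
  set Q := γ11 ^ 2 + γ21 ^ 2 - 2 * C * γ11 * γ21 with hQ
  rw [Real.sqrt_le_left hsin.le]
  constructor
  · rintro ⟨ρ, hρ, h11, h21, h12, h22⟩
    rw [htrs, h11] at h12
    rw [htrs, h21] at h22
    have h12 : s * γ11 = γ12 := by exact_mod_cast h12
    have h22 : s * γ21 = γ22 := by exact_mod_cast h22
    refine ⟨by rw [← h12, ← mul_assoc, hss, one_mul], by rw [← h22, ← mul_assoc, hss, one_mul], ?_⟩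
    have hx : (ρ * (dotSigma c ⊗ₖ dotSigma b₁)).trace = ((Q : ℝ) : ℂ) := by
      rw [hc, ds_lin, Matrix.add_kronecker, Matrix.smul_kronecker, Matrix.smul_kronecker,
        Matrix.mul_add, Matrix.mul_smul, Matrix.mul_smul, Matrix.trace_add, Matrix.trace_smul,
        Matrix.trace_smul, h11, h21, hQ]
      simp only [smul_eq_mul]
      push_cast
      ring
    have hb := bound_aux ρ hρ c b₁ hb₁ Q hx
    rw [hcn] at hb
    by_contra hlt
    push Not at hlt
    nlinarith [sq_nonneg S]
  · rintro ⟨h1, h2, h3⟩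
    obtain ⟨ρ, hρ, h⟩ := exists_aux ((1 / S ^ 2) • c + (0 : ℝ) • c) b₁ hb₁ (by
      rw [dot3_lin, dot3_comm c, dot3_lin, hcn]
      have : 1 / S ^ 2 * (1 / S ^ 2 * (S ^ 2 * Q) + 0 * (S ^ 2 * Q)) +
          0 * (1 / S ^ 2 * (S ^ 2 * Q) + 0 * (S ^ 2 * Q)) = Q / S ^ 2 := by
        field_simp
        ring
      rw [this]
      exact div_le_one_of_le₀ h3 (sq_nonneg S))
    have e11 : (ρ * (dotSigma a₁ ⊗ₖ dotSigma b₁)).trace = (γ11 : ℂ) := by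
      rw [h, dot3_lin, hca₁]
      congr 1
      field_simp
      ring
    have e21 : (ρ * (dotSigma a₂ ⊗ₖ dotSigma b₁)).trace = (γ21 : ℂ) := by
      rw [h, dot3_lin, hca₂]
      congr 1
      field_simp
      ring
    refine ⟨ρ, hρ, e11, e21, ?_, ?_⟩
    · rw [htrs, e11, h1]
      push_cast
      rw [← mul_assoc, hss', one_mul]
    · rw [htrs, e21, h2]
      push_cast
      rw [← mul_assoc, hss', one_mul]
end
end

section
/- Let C₁₁, C₂₁, C₁₂, C₂₂ be real numbers with |C_{ij}| ≤ 1 for all i, j ∈ {1,2}. Then there exist 2×2 Hermitian complex matrices A₁, A₂, B₁, B₂ with A_i² = I₂ and B_j² = I₂ for all i, j, and a density matrix ρ on ℂ²⊗ℂ², such that Tr[ρ (A_i ⊗ B_j)] = C_{ij} for all i, j ∈ {1,2}, if and only if for all k, l ∈ {1,2}, |arcsin C₁₁ + arcsin C₂₁ + arcsin C₁₂ + arcsin C₂₂ − 2·arcsin C_{kl}| ≤ π. -/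
open Matrix Kronecker Real ComplexOrder

noncomputable section

open scoped MatrixOrder in
lemma posSemidef_factor (ρ : Matrix (Fin 2 × Fin 2) (Fin 2 × Fin 2) ℂ) (h : ρ.PosSemidef) :
    ∃ S : Matrix (Fin 2 × Fin 2) (Fin 2 × Fin 2) ℂ, ρ = Sᴴ * S :=
  CStarAlgebra.nonneg_iff_eq_star_mul_self.mp h.nonneg

lemma quad_angle {V : Type*} [NormedAddCommGroup V] [InnerProductSpace ℝ V] (x y : Fin 2 → V)
    (hx : ∀ i, ‖x i‖ = 1) (hy : ∀ i, ‖y i‖ = 1) (i i' j j' : Fin 2) :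
    Real.arccos (inner ℝ (x i) (y j)) ≤ Real.arccos (inner ℝ (x i) (y j')) +
      Real.arccos (inner ℝ (x i') (y j')) + Real.arccos (inner ℝ (x i') (y j)) := by
  have e : ∀ i j, Real.arccos (inner ℝ (x i) (y j)) = InnerProductGeometry.angle (x i) (y j) := by
    intro i j
    simp [InnerProductGeometry.angle, hx, hy]
  rw [e, e, e, e]
  have h1 := InnerProductGeometry.angle_le_angle_add_angle (x i) (y j') (y j)
  have h2 := InnerProductGeometry.angle_le_angle_add_angle (y j') (x i') (y j)
  rw [InnerProductGeometry.angle_comm (y j') (x i')] at h2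
  linarith

lemma exists_vectors (A B : Fin 2 → Matrix (Fin 2) (Fin 2) ℂ)
    (hA : ∀ i, (A i).IsHermitian) (hB : ∀ j, (B j).IsHermitian)
    (hA2 : ∀ i, A i ^ 2 = 1) (hB2 : ∀ j, B j ^ 2 = 1)
    (ρ : Matrix (Fin 2 × Fin 2) (Fin 2 × Fin 2) ℂ) (hρ : IsDensityMatrix ρ)
    (C : Fin 2 → Fin 2 → ℝ)
    (hC : ∀ i j, (ρ * (A i ⊗ₖ B j)).trace = ((C i j : ℝ) : ℂ)) :
    ∃ x y : Fin 2 → EuclideanSpace ℂ ((Fin 2 × Fin 2) × (Fin 2 × Fin 2)),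
      (∀ i, ‖x i‖ = 1) ∧ (∀ i, ‖y i‖ = 1) ∧ ∀ i j, inner ℝ (x i) (y j) = C i j := by
  obtain ⟨hp, ht⟩ := hρ
  obtain ⟨S, rfl⟩ := posSemidef_factor ρ hp
  let v : Matrix (Fin 2 × Fin 2) (Fin 2 × Fin 2) ℂ →
      EuclideanSpace ℂ ((Fin 2 × Fin 2) × (Fin 2 × Fin 2)) :=
    fun M => WithLp.toLp 2 (fun p => M p.1 p.2)
  have hv : ∀ M N, inner ℂ (v M) (v N) = (N * Mᴴ).trace := by
    intro M N
    simp only [v, PiLp.inner_apply, Matrix.trace, Matrix.diag, Matrix.mul_apply,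
      Matrix.conjTranspose_apply]
    rw [Fintype.sum_prod_type]
    rfl
  have hn : ∀ U : Matrix (Fin 2 × Fin 2) (Fin 2 × Fin 2) ℂ, U * Uᴴ = 1 → ‖v (S * U)‖ = 1 := by
    intro U hU
    have h1 : inner ℂ (v (S * U)) (v (S * U)) = 1 := by
      rw [hv, Matrix.conjTranspose_mul, Matrix.mul_assoc, ← Matrix.mul_assoc U, hU,
        Matrix.one_mul, Matrix.trace_mul_comm, ht]
    rw [inner_self_eq_norm_sq_to_K] at h1
    have h2 : ‖v (S * U)‖ ^ 2 = 1 := by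
      apply Complex.ofReal_injective
      rw [Complex.ofReal_pow]
      simpa using h1
    exact (pow_eq_one_iff_of_nonneg (norm_nonneg _) two_ne_zero).mp h2
  refine ⟨fun i => v (S * (A i ⊗ₖ (1 : Matrix (Fin 2) (Fin 2) ℂ))),
    fun j => v (S * ((1 : Matrix (Fin 2) (Fin 2) ℂ) ⊗ₖ B j)), ?_, ?_, ?_⟩
  · intro i
    apply hn
    rw [Matrix.conjTranspose_kronecker, (hA i).eq, ← Matrix.mul_kronecker_mul, ← pow_two, hA2]
    simp
  · intro i
    apply hn
    rw [Matrix.conjTranspose_kronecker, (hB i).eq, ← Matrix.mul_kronecker_mul, ← pow_two, hB2]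
    simp
  · intro i j
    have : inner ℂ (v (S * (A i ⊗ₖ (1 : Matrix (Fin 2) (Fin 2) ℂ))))
        (v (S * ((1 : Matrix (Fin 2) (Fin 2) ℂ) ⊗ₖ B j))) = (C i j : ℂ) := by
      rw [hv, ← hC, Matrix.conjTranspose_mul, Matrix.conjTranspose_kronecker, (hA i).eq,
        Matrix.mul_assoc, ← Matrix.mul_assoc _ _ Sᴴ, ← Matrix.mul_kronecker_mul]
      rw [Matrix.conjTranspose_one, Matrix.mul_one, Matrix.one_mul, ← Matrix.mul_assoc,
        Matrix.trace_mul_comm, ← Matrix.mul_assoc]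
    have hre : ∀ p q : EuclideanSpace ℂ ((Fin 2 × Fin 2) × (Fin 2 × Fin 2)),
        inner ℝ p q = (inner ℂ p q).re := by
      intro p q
      rw [PiLp.inner_apply, PiLp.inner_apply, Complex.re_sum]
      rfl
    rw [hre, this, Complex.ofReal_re]

lemma forward (C : Fin 2 → Fin 2 → ℝ) {V : Type*} [NormedAddCommGroup V] [InnerProductSpace ℝ V]
    (x y : Fin 2 → V) (hx : ∀ i, ‖x i‖ = 1) (hy : ∀ i, ‖y i‖ = 1)
    (hC : ∀ i j, inner ℝ (x i) (y j) = C i j) (k l : Fin 2) :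
    |Real.arcsin (C 0 0) + Real.arcsin (C 1 0) + Real.arcsin (C 0 1) +
            Real.arcsin (C 1 1) - 2 * Real.arcsin (C k l)| ≤ π := by
  have h1 := quad_angle x y hx hy k (1 - k) l (1 - l)
  have h2 := quad_angle x (fun j => - y j) hx (by simpa using hy) k (1 - k) l (1 - l)
  simp only [inner_neg_right, hC, Real.arccos_neg] at h1 h2
  simp only [Real.arccos] at h1 h2
  rw [abs_le]
  fin_cases k <;> fin_cases l <;> simp at h1 h2 ⊢ <;> constructor <;> linarith

lemma triangle_vec (a b f : ℝ) (ha : 0 ≤ a) (ha' : a ≤ π) (hb : 0 ≤ b) (hb' : b ≤ π)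
    (hf : 0 ≤ f) (hf' : f ≤ π) (h1 : |a - b| ≤ f) (h2 : f ≤ a + b) (h3 : f ≤ 2 * π - a - b) :
    ∃ v : Fin 3 → ℝ, dot3 v v = 1 ∧ v 0 = Real.cos a ∧
      Real.cos f * v 0 + Real.sin f * v 1 = Real.cos b := by
  rw [abs_le] at h1
  have hsa := Real.sin_nonneg_of_nonneg_of_le_pi ha ha'
  have hsf := Real.sin_nonneg_of_nonneg_of_le_pi hf hf'
  have k1 : Real.cos (a + f) ≤ Real.cos b := by
    rcases le_total (a + f) π with h | h
    · exact Real.cos_le_cos_of_nonneg_of_le_pi hb h (by linarith)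
    · rw [← Real.cos_two_pi_sub (a + f)]
      exact Real.cos_le_cos_of_nonneg_of_le_pi hb (by linarith) (by linarith)
  have k2 : Real.cos b ≤ Real.cos (a - f) := by
    rw [← Real.cos_abs (a - f)]
    exact Real.cos_le_cos_of_nonneg_of_le_pi (abs_nonneg _) hb'
      (abs_le.mpr ⟨by linarith, by linarith⟩)
  rw [Real.cos_add] at k1
  rw [Real.cos_sub] at k2
  obtain ⟨y, hy1, hy2⟩ : ∃ y, |y| ≤ Real.sin a ∧
      Real.cos f * Real.cos a + Real.sin f * y = Real.cos b := by
    rcases hsf.eq_or_lt with h | h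
    · refine ⟨0, by simpa using hsa, ?_⟩
      rw [← h] at k1 k2
      linarith
    · refine ⟨(Real.cos b - Real.cos a * Real.cos f) / Real.sin f, ?_, ?_⟩
      · rw [abs_le, le_div_iff₀ h, div_le_iff₀ h]
        constructor <;> linarith
      · field_simp
        ring
  have hy3 : y ^ 2 ≤ Real.sin a ^ 2 := sq_le_sq' (abs_le.mp hy1).1 (abs_le.mp hy1).2
  refine ⟨![Real.cos a, y, √(Real.sin a ^ 2 - y ^ 2)], ?_, rfl, hy2⟩
  have := Real.mul_self_sqrt (sub_nonneg.mpr hy3)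
  simp [dot3, this]
  nlinarith [Real.sin_sq_add_cos_sq a]

lemma dotSigma_herm (a : Fin 3 → ℝ) : (dotSigma a).IsHermitian := by
  ext i j
  fin_cases i <;> fin_cases j <;> simp [dotSigma, σ1, σ2, σ3]

lemma dotSigma_sq (a : Fin 3 → ℝ) (h : dot3 a a = 1) : dotSigma a ^ 2 = 1 := by
  have h' : (a 0 : ℂ) * a 0 + a 1 * a 1 + a 2 * a 2 = 1 := by exact_mod_cast h
  rw [pow_two]
  ext i j
  fin_cases i <;> fin_cases j <;>
    simp [dotSigma, σ1, σ2, σ3, Matrix.mul_apply, Fin.sum_univ_two] <;>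
    first
      | ring1
      | linear_combination h' - (a 1 : ℂ) ^ 2 * Complex.I_sq

/-- The (unnormalised) singlet vector. -/
def singlet : Fin 2 × Fin 2 → ℂ := fun p => !![0, 1; -1, 0] p.1 p.2

def singletRho : Matrix (Fin 2 × Fin 2) (Fin 2 × Fin 2) ℂ :=
  (1 / 2 : ℝ) • Matrix.vecMulVec singlet (star singlet)

lemma singlet_density : IsDensityMatrix singletRho := by
  constructor
  · exact (Matrix.posSemidef_vecMulVec_self_star singlet).smul (by norm_num)
  · simp [singletRho, Matrix.trace, Fintype.sum_prod_type, Fin.sum_univ_two, singlet,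
      Matrix.vecMulVec_apply]
    norm_num

lemma singlet_corr (a b : Fin 3 → ℝ) :
    (singletRho * (dotSigma a ⊗ₖ (dotSigma (-b)))).trace = ((dot3 a b : ℝ) : ℂ) := by
  simp [singletRho, Matrix.trace, Fintype.sum_prod_type, Fin.sum_univ_two, singlet,
      Matrix.vecMulVec_apply, Matrix.mul_apply, dotSigma, σ1, σ2, σ3, dot3]
  ring_nf
  simp

lemma backward (t : Fin 2 → Fin 2 → ℝ) (h0 : ∀ i j, 0 ≤ t i j) (h1 : ∀ i j, t i j ≤ π)
    (h : ∀ k l, t k l ≤ t (1 - k) l + t k (1 - l) + t (1 - k) (1 - l) ∧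
      t (1 - k) l + t k (1 - l) + t (1 - k) (1 - l) - t k l ≤ 2 * π) :
    ∃ a b : Fin 2 → Fin 3 → ℝ, (∀ i, dot3 (a i) (a i) = 1) ∧ (∀ i, dot3 (b i) (b i) = 1) ∧
      ∀ i j, dot3 (a i) (b j) = Real.cos (t i j) := by
  obtain ⟨f, hf⟩ : ∃ f, ∀ j, |t 0 j - t 1 j| ≤ f ∧ f ≤ t 0 j + t 1 j ∧
      f ≤ 2 * π - t 0 j - t 1 j := by
    have a1 := h 0 0
    have a2 := h 0 1
    have a3 := h 1 0
    have a4 := h 1 1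
    simp at a1 a2 a3 a4
    have b1 := h0 0 0
    have b2 := h0 0 1
    have b3 := h0 1 0
    have b4 := h0 1 1
    have c1 := h1 0 0
    have c2 := h1 0 1
    have c3 := h1 1 0
    have c4 := h1 1 1
    refine ⟨max |t 0 0 - t 1 0| |t 0 1 - t 1 1|, ?_⟩
    intro j
    fin_cases j
    · refine ⟨le_max_left _ _, ?_, ?_⟩ <;> 
      · simp only [max_le_iff, abs_le]
        refine ⟨⟨?_, ?_⟩, ?_, ?_⟩ <;> simp <;> linarith
    · refine ⟨le_max_right _ _, ?_, ?_⟩ <;> 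
      · simp only [max_le_iff, abs_le]
        refine ⟨⟨?_, ?_⟩, ?_, ?_⟩ <;> simp <;> linarith
  have f0 : 0 ≤ f := (abs_nonneg _).trans (hf 0).1
  have f1 : f ≤ π := by linarith [(hf 0).2.1, (hf 0).2.2]
  have hb := fun j => triangle_vec (t 0 j) (t 1 j) f (h0 _ _) (h1 _ _) (h0 _ _) (h1 _ _) f0 f1
    (hf j).1 (hf j).2.1 (hf j).2.2
  choose b hb1 hb2 hb3 using hb
  refine ⟨![![1, 0, 0], ![Real.cos f, Real.sin f, 0]], b, ?_, hb1, ?_⟩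
  · intro i
    fin_cases i
    · simp [dot3]
    · simp [dot3]
      nlinarith [Real.sin_sq_add_cos_sq f]
  · intro i j
    fin_cases i
    · simp [dot3, hb2]
    · simpa [dot3] using hb3 j

/-- (Tsirel'son–Landau) For `|Cᵢⱼ| ≤ 1`, there exist ±1-valued
observables (Hermitian `2×2` matrices squaring to the identity) `A₁, A₂, B₁, B₂`
and a density matrix `ρ` on `ℂ²⊗ℂ²` with `Tr[ρ (Aᵢ ⊗ Bⱼ)] = Cᵢⱼ` iff for all `k, l`,
`|arcsin C₁₁ + arcsin C₂₁ + arcsin C₁₂ + arcsin C₂₂ − 2 arcsin C_{kl}| ≤ π`.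
Here `C i j` is zero-based: `C 0 0 = C₁₁`, `C 1 0 = C₂₁`, `C 0 1 = C₁₂`, `C 1 1 = C₂₂`. -/
theorem stmt14 (C : Fin 2 → Fin 2 → ℝ) (h : ∀ i j, |C i j| ≤ 1) :
    (∃ (A B : Fin 2 → Matrix (Fin 2) (Fin 2) ℂ),
        (∀ i, (A i).IsHermitian) ∧ (∀ j, (B j).IsHermitian) ∧
        (∀ i, A i ^ 2 = 1) ∧ (∀ j, B j ^ 2 = 1) ∧
        ∃ ρ : Matrix (Fin 2 × Fin 2) (Fin 2 × Fin 2) ℂ, IsDensityMatrix ρ ∧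
          ∀ i j, (ρ * (A i ⊗ₖ B j)).trace = ((C i j : ℝ) : ℂ)) ↔
      (∀ k l : Fin 2,
        |Real.arcsin (C 0 0) + Real.arcsin (C 1 0) + Real.arcsin (C 0 1) +
            Real.arcsin (C 1 1) - 2 * Real.arcsin (C k l)| ≤ π) := by
  constructor
  · rintro ⟨A, B, hA, hB, hA2, hB2, ρ, hρ, hC⟩ k l
    obtain ⟨x, y, hx, hy, hxy⟩ := exists_vectors A B hA hB hA2 hB2 ρ hρ C hC
    exact forward C x y hx hy hxy k l
  · intro H
    obtain ⟨a, b, ha, hb, hab⟩ := backward (fun i j => Real.arccos (C i j))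
      (fun i j => Real.arccos_nonneg _) (fun i j => Real.arccos_le_pi _) (by
        intro k l
        have := abs_le.mp (H k l)
        simp only [Real.arccos]
        fin_cases k <;> fin_cases l <;> simp at this ⊢ <;> constructor <;> linarith)
    refine ⟨fun i => dotSigma (a i), fun j => dotSigma (-b j), fun i => dotSigma_herm _,
      fun j => dotSigma_herm _, fun i => dotSigma_sq _ (ha i), fun j => dotSigma_sq _ ?_,
      singletRho, singlet_density, ?_⟩
    · simpa [dot3] using hb j
    · intro i j
      rw [singlet_corr, hab, Real.cos_arccos (abs_le.mp (h i j)).1 (abs_le.mp (h i j)).2]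
end
end
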